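/- Every positive Borel measure μ on ℝ^p that is almost periodic in the sense of distributions (i.e., φ * μ is almost periodic for every φ ∈ C_c^∞) satisfies sup_{c ∈ ℝ^p} μ(B(c,1)) < ∞. -/

import Mathlib

open Metric Set MeasureTheory

/-- A set is relatively dense if some radius `R` works: every ball of radius `R` meets it. -/
def RelativelyDense {E : Type*} [PseudoMetricSpace E] (S : Set E) : Prop :=
  ∃ R : ℝ, 0 < R ∧ ∀ c : E, ∃ τ ∈ S, dist τ c < R

/-- Bohr almost periodicity: for every `ε > 0` the set of `ε`-almost periods is relatively dense. -/
def AlmostPeriodic {E : Type*} [SeminormedAddCommGroup E] (f : E → ℝ) : Prop :=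
  ∀ ε : ℝ, 0 < ε → RelativelyDense {τ : E | ∀ x : E, |f (x + τ) - f x| < ε}

/-- A measure against which a nonnegative integrable function is at least `1` on `s` gives `s`
mass at most the integral of that function. -/
lemma measure_le_ofReal_integral_of_one_le {α : Type*} [MeasurableSpace α] {μ : Measure α}
    {f : α → ℝ} {s : Set α} (hf : Integrable f μ) (hf0 : ∀ t, 0 ≤ f t) (hs : MeasurableSet s)
    (hfs : ∀ t ∈ s, 1 ≤ f t) : μ s ≤ ENNReal.ofReal (∫ t, f t ∂μ) := by
  rw [ofReal_integral_eq_lintegral_ofReal hf (Filter.Eventually.of_forall hf0),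
    ← lintegral_indicator_one hs]
  refine lintegral_mono fun t => ?_
  by_cases ht : t ∈ s
  · simpa [ht] using hfs t ht
  · simp [ht]

/-- a positive Borel measure on ℝ^p that is almost periodic in the sense of
distributions (all convolutions with `C_c^∞` test functions are defined and almost periodic)
has uniformly bounded mass on unit balls. -/
theorem statement12 {p : ℕ} (μ : Measure (EuclideanSpace ℝ (Fin p)))
    (hap : ∀ φ : EuclideanSpace ℝ (Fin p) → ℝ, ContDiff ℝ (⊤ : ℕ∞) φ → HasCompactSupport φ →
      (∀ x, Integrable (fun t => φ (x + t)) μ) ∧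
        AlmostPeriodic fun x => ∫ t, φ (x + t) ∂μ) :
    ∃ M : ENNReal, M ≠ ⊤ ∧ ∀ c : EuclideanSpace ℝ (Fin p), μ (Metric.ball c 1) < M := by
  let φ : ContDiffBump (0 : EuclideanSpace ℝ (Fin p)) := ⟨1, 2, one_pos, one_lt_two⟩
  obtain ⟨hφ, hφap⟩ := hap φ φ.contDiff φ.hasCompactSupport
  obtain ⟨R, hR, hτ⟩ := hφap 1 one_pos
  let ψ : ContDiffBump (0 : EuclideanSpace ℝ (Fin p)) :=
    ⟨R + 2, R + 3, by linarith, by linarith⟩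
  have hψ := (hap ψ ψ.contDiff ψ.hasCompactSupport).1 0
  refine ⟨ENNReal.ofReal ((∫ t, ψ (0 + t) ∂μ) + 1) + 1, by simp, fun c => ?_⟩
  obtain ⟨τ, hτ, hτc⟩ := hτ c
  rw [dist_eq_norm] at hτc
  have hball : μ (ball c 1) ≤ ENNReal.ofReal (∫ t, φ (-c + t) ∂μ) := by
    refine measure_le_ofReal_integral_of_one_le (hφ _) (fun _ => φ.nonneg) measurableSet_ball
      fun t ht => (φ.one_of_mem_closedBall ?_).ge
    rw [mem_ball, dist_eq_norm] at ht
    rw [mem_closedBall, dist_zero_right, neg_add_eq_sub]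
    exact ht.le
  have hle : ∫ t, φ (-c + τ + t) ∂μ ≤ ∫ t, ψ (0 + t) ∂μ := by
    refine integral_mono (hφ _) hψ fun t => ?_
    by_cases ht : ‖-c + τ + t‖ < 2
    · have htR : ‖t‖ ≤ R + 2 := by
        have h := norm_sub_le (-c + τ + t) (τ - c)
        rw [show -c + τ + t - (τ - c) = t by abel] at h
        linarith
      exact φ.le_one.trans (ψ.one_of_mem_closedBall (by simpa [ψ] using htR)).ge
    · have h0 : φ (-c + τ + t) = 0 :=
        φ.zero_of_le_dist (by simpa only [dist_zero_right] using not_lt.mp ht)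
      exact h0.le.trans ψ.nonneg
  have hshift := (abs_lt.mp (hτ (-c))).1
  refine (hball.trans (ENNReal.ofReal_le_ofReal ?_)).trans_lt
    (ENNReal.lt_add_right ENNReal.ofReal_ne_top one_ne_zero)
  linarith
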